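/- Let b : ℤ^l → ℂ satisfy a polynomial growth bound: there exist C > 0 and an integer N > 0 with |b_m| ≤ C(1 + |m|²)^N for all m ∈ ℤ^l. Fix t > 0 and Ω ∈ 𝕳_l. If Σ_{m∈ℤ^l} b_m exp(πi t m·Ωm + 2πi m·z) = 0 for all z ∈ ℂ^l, then b_m = 0 for all m ∈ ℤ^l; that is, the coherent state transform is injective on distributions with polynomially growing Fourier coefficients. -/

import Mathlib

open Complex Filter Matrix

/-- A product of one-variable nonnegative summable functions is summable over the product. -/
theorem summable_fin_prod_of_nonneg {α : Type*} {f : α → ℝ} (hf : Summable f)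
    (hf0 : ∀ a, 0 ≤ f a) (n : ℕ) : Summable fun m : Fin n → α ↦ ∏ i, f (m i) := by
  induction n with
  | zero => exact (hasSum_fintype _).summable
  | succ n ih =>
    rw [← (Fin.consEquiv fun _ : Fin (n + 1) ↦ α).summable_iff]
    refine (hf.mul_of_nonneg ih hf0 fun m ↦ Finset.prod_nonneg fun i _ ↦ hf0 _).congr fun p ↦ ?_
    simp [Fin.prod_univ_succ, Fin.consEquiv]

theorem summable_int_one_add_sq_inv : Summable fun k : ℤ ↦ (1 + (k : ℝ) ^ 2)⁻¹ := by
  refine Summable.of_norm_bounded_eventually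
    (Real.summable_one_div_int_pow.mpr one_lt_two) ?_
  filter_upwards [(Set.finite_singleton (0 : ℤ)).compl_mem_cofinite] with k hk
  have hk' : (k : ℝ) ≠ 0 := by exact_mod_cast hk
  rw [Real.norm_of_nonneg (by positivity), one_div]
  gcongr
  linarith

/-- Polynomial growth is absorbed by exponential decay. -/
theorem one_add_pow_mul_exp_neg_le {c s : ℝ} (hc : 0 < c) (hs : 0 ≤ s) (K : ℕ) :
    (1 + s) ^ K * Real.exp (-(c * s)) ≤ K.factorial * Real.exp c / c ^ K := by
  have h := Real.pow_div_factorial_le_exp (c * (1 + s)) (by positivity) K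
  rw [div_le_iff₀ (by positivity), mul_pow, mul_add, mul_one, Real.exp_add] at h
  rw [le_div_iff₀ (by positivity), Real.exp_neg, ← div_eq_mul_inv, div_mul_eq_mul_div,
    div_le_iff₀ (by positivity)]
  linarith

/-- A positive definite real quadratic form dominates a positive multiple of the sum of squares. -/
theorem Matrix.PosDef.exists_pos_mul_sum_sq_le {ι : Type*} [Fintype ι] {A : Matrix ι ι ℝ}
    (hA : A.PosDef) : ∃ c : ℝ, 0 < c ∧ ∀ x : ι → ℝ, c * ∑ j, x j ^ 2 ≤ x ⬝ᵥ (A *ᵥ x) := by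
  rcases isEmpty_or_nonempty ι with hι | hι
  · exact ⟨1, one_pos, fun x ↦ by simp⟩
  have hcont : Continuous fun x : EuclideanSpace ℝ ι ↦ (x.ofLp) ⬝ᵥ (A *ᵥ x.ofLp) := by
    fun_prop
  obtain ⟨u, hu, hmin⟩ := (isCompact_sphere (0 : EuclideanSpace ℝ ι) 1).exists_isMinOn
    (NormedSpace.sphere_nonempty.mpr zero_le_one) hcont.continuousOn
  have hu0 : u.ofLp ≠ 0 := by
    intro h
    have : u = 0 := by ext i; simp [h]
    simp [this] at hu
  refine ⟨_, by simpa using hA.dotProduct_mulVec_pos hu0, fun x ↦ ?_⟩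
  set y : EuclideanSpace ℝ ι := WithLp.toLp 2 x with hy
  have hsum : ∑ j, x j ^ 2 = ‖y‖ ^ 2 := by
    simp [EuclideanSpace.norm_sq_eq, hy]
  rw [hsum]
  by_cases hy0 : y = 0
  · have hx : x = 0 := by simpa [hy] using hy0
    simp [hy0, hx]
  have hn : 0 < ‖y‖ := norm_pos_iff.mpr hy0
  have hmem : ‖y‖⁻¹ • y ∈ Metric.sphere (0 : EuclideanSpace ℝ ι) 1 := by
    simp [norm_smul, hn.ne']
  have h := hmin hmem
  simp only [Set.mem_ofPred_eq, WithLp.ofLp_smul, Matrix.mulVec_smul, smul_dotProduct,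
    dotProduct_smul, smul_eq_mul, hy] at h
  rw [← hy] at h
  calc _ ≤ (‖y‖⁻¹ * (‖y‖⁻¹ * x ⬝ᵥ (A *ᵥ x))) * ‖y‖ ^ 2 := by gcongr
    _ = _ := by field_simp

/-- The measure on `ℝ / ℤ` underlying `UnitAddTorus.mFourierLp`. -/
noncomputable local instance unitAddCircleMeasureSpace :
    MeasureTheory.MeasureSpace UnitAddCircle :=
  ⟨AddCircle.haarAddCircle⟩

local instance unitAddCircleIsProbabilityMeasure :
    MeasureTheory.IsProbabilityMeasure (MeasureTheory.volume : MeasureTheory.Measure UnitAddCircle) :=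
  inferInstanceAs (MeasureTheory.IsProbabilityMeasure AddCircle.haarAddCircle)

/-- An absolutely convergent multiple Fourier series that vanishes at every real point has zero
coefficients. -/
theorem eq_zero_of_forall_tsum_mul_exp_eq_zero {ι : Type*} [Fintype ι] {a : (ι → ℤ) → ℂ}
    (ha : Summable fun m ↦ ‖a m‖)
    (h : ∀ x : ι → ℝ, ∑' m : ι → ℤ,
      a m * Complex.exp (2 * Real.pi * Complex.I * ∑ i, (m i : ℂ) * (x i : ℂ)) = 0)
    (k : ι → ℤ) : a k = 0 := by
  have hs : Summable fun m ↦ a m • (UnitAddTorus.mFourier m : C(UnitAddTorus ι, ℂ)) :=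
    Summable.of_norm (by simpa [norm_smul, UnitAddTorus.mFourier_norm] using ha)
  have hzero : ∑' m, a m • (UnitAddTorus.mFourier m : C(UnitAddTorus ι, ℂ)) = 0 := by
    ext y
    obtain ⟨x, rfl⟩ : ∃ x : ι → ℝ, (fun i ↦ (x i : UnitAddCircle)) = y :=
      ⟨fun i ↦ (QuotientAddGroup.mk_surjective (y i)).choose,
        funext fun i ↦ (QuotientAddGroup.mk_surjective (y i)).choose_spec⟩
    rw [← ContinuousMap.tsum_apply hs, ContinuousMap.zero_apply, ← h x]
    refine tsum_congr fun m ↦ ?_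
    simp only [ContinuousMap.smul_apply, smul_eq_mul, UnitAddTorus.mFourier, ContinuousMap.coe_mk,
      fourier_coe_apply, ← Complex.exp_sum, Finset.mul_sum]
    congr 2
    refine Finset.sum_congr rfl fun i _ ↦ ?_
    push_cast
    ring
  have hsum := hs.hasSum
  rw [hzero] at hsum
  have hL : HasSum (fun m ↦ a m • UnitAddTorus.mFourierLp (d := ι) 2 m) 0 := by
    simpa using hsum.mapL (ContinuousMap.toLp 2 MeasureTheory.volume ℂ)
  have hI := hL.mapL (innerSL ℂ (UnitAddTorus.mFourierLp (d := ι) 2 k))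
  classical
  simp only [map_smul, innerSL_apply_apply, map_zero, smul_eq_mul,
    orthonormal_iff_ite.mp UnitAddTorus.orthonormal_mFourier] at hI
  have := hI.unique (hasSum_single k fun m hm ↦ by simp [hm.symm])
  simpa using this.symm

theorem statement_7 (l : ℕ) (hl : 1 ≤ l) (b : (Fin l → ℤ) → ℂ)
    (hb : ∃ C : ℝ, 0 < C ∧ ∃ N : ℕ, 0 < N ∧
      ∀ m : Fin l → ℤ, ‖b m‖ ≤ C * (1 + ∑ j, ((m j : ℝ)) ^ 2) ^ N)
    (t : ℝ) (ht : 0 < t)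
    (Ω : Matrix (Fin l) (Fin l) ℂ) (hsym : Ωᵀ = Ω)
    (hpos : (Ω.map Complex.im).PosDef)
    (hvanish : ∀ z : Fin l → ℂ,
      (∑' m : Fin l → ℤ, b m * Complex.exp (Real.pi * Complex.I * t *
          (∑ i, ∑ j, (m i : ℂ) * Ω i j * (m j : ℂ)) +
        2 * Real.pi * Complex.I * ∑ i, (m i : ℂ) * z i)) = 0) :
    ∀ m : Fin l → ℤ, b m = 0 := by
  obtain ⟨C, hC, N, -, hbound⟩ := hb
  obtain ⟨c, hc, hquad⟩ := hpos.exists_pos_mul_sum_sq_le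
  set w : (Fin l → ℤ) → ℂ := fun m ↦ Complex.exp (Real.pi * Complex.I * t *
    (∑ i, ∑ j, (m i : ℂ) * Ω i j * (m j : ℂ))) with hw
  have him (m : Fin l → ℤ) : (∑ i, ∑ j, (m i : ℂ) * Ω i j * (m j : ℂ)).im =
      (fun i ↦ (m i : ℝ)) ⬝ᵥ (Ω.map Complex.im *ᵥ fun i ↦ (m i : ℝ)) := by
    simp only [dotProduct, mulVec, Complex.im_sum, Finset.mul_sum, Matrix.map_apply]
    refine Finset.sum_congr rfl fun i _ ↦ Finset.sum_congr rfl fun j _ ↦ ?_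
    simp [mul_assoc]
  have hw_le (m : Fin l → ℤ) :
      ‖w m‖ ≤ Real.exp (-(Real.pi * t * c * ∑ j, (m j : ℝ) ^ 2)) := by
    have hre : (Real.pi * Complex.I * t * (∑ i, ∑ j, (m i : ℂ) * Ω i j * (m j : ℂ))).re =
        -(Real.pi * t * (∑ i, ∑ j, (m i : ℂ) * Ω i j * (m j : ℂ)).im) := by
      rw [Complex.mul_re]
      simp
    rw [hw, Complex.norm_exp, hre, him, Real.exp_le_exp, neg_le_neg_iff, mul_assoc _ c]
    exact mul_le_mul_of_nonneg_left (hquad _) (by positivity)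
  have hc' : 0 < Real.pi * t * c := by positivity
  have hsummable : Summable fun m ↦ ‖b m * w m‖ := by
    refine Summable.of_nonneg_of_le (fun _ ↦ norm_nonneg _) (fun m ↦ ?_)
      ((summable_fin_prod_of_nonneg summable_int_one_add_sq_inv (fun _ ↦ by positivity) l).mul_left
        (C * ((N + l).factorial * Real.exp (Real.pi * t * c) / (Real.pi * t * c) ^ (N + l))))
    set s := ∑ j, (m j : ℝ) ^ 2 with hs
    have hs0 : 0 ≤ s := Finset.sum_nonneg fun _ _ ↦ sq_nonneg _
    have hprod : ((1 + s) ^ l)⁻¹ ≤ ∏ j, (1 + (m j : ℝ) ^ 2)⁻¹ := by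
      rw [Finset.prod_inv_distrib]
      gcongr
      calc ∏ j, (1 + (m j : ℝ) ^ 2) ≤ ∏ _j : Fin l, (1 + s) := by
            refine Finset.prod_le_prod (fun _ _ ↦ by positivity) fun j _ ↦ ?_
            gcongr
            exact Finset.single_le_sum (f := fun j ↦ (m j : ℝ) ^ 2)
              (fun _ _ ↦ sq_nonneg _) (Finset.mem_univ j)
        _ = (1 + s) ^ l := by simp
    calc ‖b m * w m‖ ≤ (C * (1 + s) ^ N) * Real.exp (-(Real.pi * t * c * s)) := by
          rw [norm_mul]
          exact mul_le_mul (hbound m) (hw_le m) (norm_nonneg _) (by positivity)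
      _ = C * ((1 + s) ^ (N + l) * Real.exp (-(Real.pi * t * c * s))) * ((1 + s) ^ l)⁻¹ := by
          rw [pow_add]
          field_simp
      _ ≤ _ := by
          gcongr
          exact one_add_pow_mul_exp_neg_le hc' hs0 _
  intro k
  have hzero := eq_zero_of_forall_tsum_mul_exp_eq_zero hsummable (fun x ↦ by
    rw [← hvanish fun i ↦ (x i : ℂ)]
    exact tsum_congr fun m ↦ by rw [hw, Complex.exp_add, mul_assoc]) k
  exact (mul_eq_zero.mp hzero).resolve_right (Complex.exp_ne_zero _)
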